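/- arXiv:0812.1078 — 3 statements merged into one kernel-verified Lean document; each statement's English description precedes it below -/
import Mathlib

section
/- Let g be a finite-dimensional complex semisimple Lie algebra with Cartan subalgebra h, and let V be a nonzero finite-dimensional representation of g that is weight multiplicity free with respect to h. If all weights of V are congruent to one another modulo the root lattice of g (i.e. the difference of any two weights of V lies in the additive subgroup of h* generated by the roots of g with respect to h), then V is an irreducible representation of g. -/
open LieAlgebra LieAlgebra.IsKilling LieModule in
/-- A sum of roots pairing non-positively with the coroot of every summand vanishes. -/
lemma wmf_sum_roots_eq_zero
    {L : Type*} [LieRing L] [LieAlgebra ℂ L] [FiniteDimensional ℂ L] [IsKilling ℂ L]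
    (H : LieSubalgebra ℂ L) [H.IsCartanSubalgebra]
    (s : Multiset H.root)
    (hs : ∀ i ∈ s, ∃ n : ℕ,
      (s.map (rootSystem H).root).sum ((rootSystem H).coroot i) = -(n : ℂ)) :
    (s.map (rootSystem H).root).sum = 0 := by
  classical
  open scoped ComplexOrder in
  set P := rootSystem H with hP
  set x := (s.map P.root).sum with hx
  have hint : ∀ j, ∃ z : ℤ, x (P.coroot j) = z := by
    intro j
    rw [hx]
    clear hs hx x
    induction s using Multiset.induction_on with
    | empty => exact ⟨0, by simp⟩
    | cons a s ih =>
      obtain ⟨z, hz⟩ := ih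
      obtain ⟨w, hw⟩ : ∃ w : ℤ, (w : ℂ) = P.pairing a j :=
        ⟨_, P.algebraMap_pairingIn ℤ a j⟩
      refine ⟨w + z, ?_⟩
      rw [Multiset.map_cons, Multiset.sum_cons, LinearMap.add_apply, hz]
      have : P.root a (P.coroot j) = P.pairing a j := rfl
      rw [this]
      push_cast
      rw [← hw]
  have hBi : ∀ i, 0 ≤ P.RootForm (P.root i) (P.root i) := by
    intro i
    rw [P.rootForm_root_self]
    refine Finset.sum_nonneg fun j _ => ?_
    obtain ⟨w, hw⟩ : ∃ w : ℤ, (w : ℂ) = P.pairing i j :=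
      ⟨_, P.algebraMap_pairingIn ℤ i j⟩
    rw [← hw]
    have := mul_self_nonneg (w : ℝ)
    exact_mod_cast this
  have h1 : ∀ i, 2 * P.RootForm (P.root i) x =
      P.RootForm (P.root i) (P.root i) * x (P.coroot i) := by
    intro i
    have := congrArg (fun y => x y) (P.rootForm_self_smul_coroot i)
    simp only [map_smul, smul_eq_mul, map_nsmul] at this
    rw [this, ← P.toLinearMap_apply_apply_Polarization]
    simp [hP]
  have h2 : 2 * P.RootForm x x = (s.map fun i => 2 * P.RootForm (P.root i) x).sum := by
    have : ∀ y, 2 * P.RootForm ((s.map P.root).sum) y =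
        (s.map fun i => 2 * P.RootForm (P.root i) y).sum := by
      intro y
      clear hs hx hint h1 x
      induction s using Multiset.induction_on with
      | empty => simp
      | cons a s ih => simp [mul_add, ih]
    exact this x
  have h3 : 2 * P.RootForm x x ≤ 0 := by
    rw [h2, ← neg_nonneg, ← Multiset.sum_map_neg', Multiset.map_map]
    refine Multiset.sum_nonneg fun y hy => ?_
    obtain ⟨i, hi, rfl⟩ := Multiset.mem_map.1 hy
    obtain ⟨n, hn⟩ := hs i hi
    rw [Function.comp_apply, h1, hn, mul_neg, neg_neg]
    exact mul_nonneg (hBi i) (Nat.cast_nonneg n)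
  have hsq : ∀ j, 0 ≤ P.coroot' j x * P.coroot' j x := by
    intro j
    obtain ⟨w, hw⟩ := hint j
    have e : P.coroot' j x = w := hw
    rw [e]
    have := mul_self_nonneg (w : ℝ)
    exact_mod_cast this
  have h4 : P.RootForm x x = 0 := by
    have h0 : 0 ≤ P.RootForm x x := by
      rw [P.rootForm_apply_apply]; exact Finset.sum_nonneg fun j _ => hsq j
    have h5 : P.RootForm x x + P.RootForm x x ≤ 0 := by rwa [← two_mul]
    exact le_antisymm ((le_add_of_nonneg_left h0).trans h5) h0
  rw [P.rootForm_apply_apply, Finset.sum_eq_zero_iff_of_nonneg fun j _ => hsq j] at h4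
  have h6 : ∀ j, x (P.coroot j) = 0 := fun j => mul_self_eq_zero.1 (h4 j (Finset.mem_univ j))
  have h7 : (⊤ : Submodule ℂ H) ≤ LinearMap.ker x := by
    rw [← RootPairing.IsRootSystem.span_coroot_eq_top (P := P), Submodule.span_le]
    rintro _ ⟨j, rfl⟩
    exact h6 j
  ext y
  exact h7 (Submodule.mem_top (x := y))

open LieAlgebra LieAlgebra.IsKilling LieModule in
/-- In a multiplicity free module, generalized weight vectors are weight vectors. -/
lemma wmf_lie_eq_smul
    {L : Type*} [LieRing L] [LieAlgebra ℂ L] [LieRing.IsNilpotent L]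
    {V : Type*} [AddCommGroup V] [Module ℂ V] [LieRingModule L V] [LieModule ℂ L V]
    [FiniteDimensional ℂ V] {χ : L → ℂ}
    (hmf : genWeightSpace V χ ≠ ⊥ → Module.finrank ℂ (genWeightSpace V χ) = 1)
    {v : V} (hv : v ∈ genWeightSpace V χ) (x : L) : ⁅x, v⁆ = χ x • v := by
  by_cases hb : genWeightSpace V χ = ⊥
  · rw [hb, LieSubmodule.mem_bot] at hv
    simp [hv]
  obtain ⟨w, hw0, hw⟩ := exists_forall_lie_eq_smul ℂ L V ⟨χ, hb⟩
  have hwm : w ∈ genWeightSpace V χ :=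
    weightSpace_le_genWeightSpace V χ ((mem_weightSpace χ w).2 hw)
  obtain ⟨c, hc⟩ := (finrank_eq_one_iff_of_nonzero' (⟨w, hwm⟩ : genWeightSpace V χ)
    (by simpa using hw0)).1 (hmf hb) ⟨v, hv⟩
  have hc : c • w = v := congrArg Subtype.val hc
  rw [← hc, lie_smul, hw, smul_comm]; rfl

open LieAlgebra LieAlgebra.IsKilling LieModule in
lemma wmf_main
    {L : Type*} [LieRing L] [LieAlgebra ℂ L] [FiniteDimensional ℂ L] [IsKilling ℂ L]
    (H : LieSubalgebra ℂ L) [H.IsCartanSubalgebra]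
    {V : Type*} [AddCommGroup V] [Module ℂ V] [LieRingModule L V] [LieModule ℂ L V]
    [FiniteDimensional ℂ V]
    (hmf : ∀ χ : H → ℂ, genWeightSpace V χ ≠ ⊥ →
      Module.finrank ℂ (genWeightSpace V χ) = 1)
    (W : LieSubmodule ℂ L V) (k : ℕ) :
    ∀ (s : Multiset H.root) (μ ν : H → ℂ) (v w : V), s.card = k →
      v ∈ genWeightSpace V μ → v ∈ W → v ≠ 0 → w ∈ genWeightSpace V ν → w ∉ W →
      μ - ν = ⇑((s.map (rootSystem H).root).sum) → False := by
  induction k with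
  | zero =>
    intro s μ ν v w hk hv hvW hv0 hw hwW h
    rw [Multiset.card_eq_zero] at hk
    subst hk
    have h : μ = ν := sub_eq_zero.1 h
    subst h
    have hb : genWeightSpace V μ ≠ ⊥ := by
      intro hb
      rw [hb, LieSubmodule.mem_bot] at hv
      exact hv0 hv
    obtain ⟨c, hc⟩ := (finrank_eq_one_iff_of_nonzero' (⟨v, hv⟩ : genWeightSpace V μ)
      (by simpa using hv0)).1 (hmf μ hb) ⟨w, hw⟩
    have hc : c • v = w := congrArg Subtype.val hc
    exact hwW (hc ▸ W.smul_mem c hvW)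
  | succ k ih =>
    intro s μ ν v w hk hv hvW hv0 hw hwW h
    by_cases hx : (s.map (rootSystem H).root).sum = 0
    · have hb : genWeightSpace V μ ≠ ⊥ := by
        intro hb
        rw [hb, LieSubmodule.mem_bot] at hv
        exact hv0 hv
      rw [hx] at h
      have h : μ = ν := sub_eq_zero.1 h
      subst h
      obtain ⟨c, hc⟩ := (finrank_eq_one_iff_of_nonzero' (⟨v, hv⟩ : genWeightSpace V μ)
        (by simpa using hv0)).1 (hmf μ hb) ⟨w, hw⟩
      have hc : c • v = w := congrArg Subtype.val hc
      exact hwW (hc ▸ W.smul_mem c hvW)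
    have hex : ∃ i ∈ s, ¬ ∃ n : ℕ,
        (s.map (rootSystem H).root).sum ((rootSystem H).coroot i) = -(n : ℂ) := by
      by_contra hcon
      push Not at hcon
      exact hx (wmf_sum_roots_eq_zero H s hcon)
    obtain ⟨i, hi, hn⟩ := hex
    obtain ⟨t, rfl⟩ := Multiset.exists_cons_of_mem hi
    have ht : t.card = k := by simpa using hk
    have hα : i.1.IsNonZero := (Finset.mem_filter.1 i.2).2
    obtain ⟨h', e, f, hsl, he, hf⟩ := exists_isSl2Triple_of_weight_isNonZero hα
    have hh := hsl.h_eq_coroot hα he hf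
    have hsum : ∀ y : H, μ y - ν y = i.1 y + (t.map (rootSystem H).root).sum y := by
      intro y
      have := congrFun h y
      simpa using this
    by_cases hfv : ⁅f, v⁆ = 0
    · by_cases hew : ⁅e, w⁆ ∈ W
      · -- both vectors are extremal
        have p1 : hsl.symm.HasPrimitiveVectorWith v (-(μ (coroot i.1))) := by
          refine ⟨hv0, ?_, hfv⟩
          rw [neg_lie, hh, neg_smul, neg_inj]
          exact wmf_lie_eq_smul (hmf μ) hv (coroot i.1)
        have p2 : hsl.HasPrimitiveVectorWith (LieSubmodule.Quotient.mk' W w)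
            (ν (coroot i.1)) := by
          refine ⟨?_, ?_, ?_⟩
          · rwa [Ne, LieSubmodule.Quotient.mk_eq_zero]
          · rw [← LieModuleHom.map_lie, hh, ← _root_.map_smul]
            exact congrArg (LieSubmodule.Quotient.mk' W)
              (wmf_lie_eq_smul (hmf ν) hw (coroot i.1))
          · rwa [← LieModuleHom.map_lie, LieSubmodule.Quotient.mk_eq_zero]
        obtain ⟨n, hn1⟩ := p1.exists_nat
        obtain ⟨m, hm1⟩ := p2.exists_nat
        apply hn
        refine ⟨n + m, ?_⟩
        have := congrFun h (coroot i.1)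
        rw [rootSystem_coroot_apply, ← this, Pi.sub_apply, hm1]
        push_cast
        rw [← hn1]; ring
      · refine ih t μ (i.1 + ν) v ⁅e, w⁆ ht hv hvW hv0
          (lie_mem_genWeightSpace_of_mem_genWeightSpace he hw) hew ?_
        funext y
        have := hsum y
        simp only [Pi.sub_apply, Pi.add_apply]
        linear_combination this
    · refine ih t (-i.1 + μ) ν ⁅f, v⁆ w ht
        (lie_mem_genWeightSpace_of_mem_genWeightSpace hf hv) (W.lie_mem hvW) hfv hw hwW ?_
      funext y
      have := hsum y
      simp only [Pi.sub_apply, Pi.add_apply, Pi.neg_apply]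
      linear_combination this

open LieAlgebra LieAlgebra.IsKilling LieModule in
/-- Every element of the root lattice is a sum of roots. -/
lemma wmf_exists_multiset
    {L : Type*} [LieRing L] [LieAlgebra ℂ L] [FiniteDimensional ℂ L] [IsKilling ℂ L]
    (H : LieSubalgebra ℂ L) [H.IsCartanSubalgebra] (δ : H → ℂ)
    (hδ : δ ∈ AddSubgroup.closure {α : H → ℂ | α ≠ 0 ∧ genWeightSpace L α ≠ ⊥}) :
    ∃ s : Multiset H.root, δ = ⇑((s.map (rootSystem H).root).sum) := by
  induction hδ using AddSubgroup.closure_induction with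
  | mem α hα =>
    refine ⟨{⟨⟨α, hα.2⟩, Finset.mem_filter.2 ⟨Finset.mem_univ _, hα.1⟩⟩}, ?_⟩
    rw [Multiset.map_singleton, Multiset.sum_singleton]; rfl
  | zero => exact ⟨0, rfl⟩
  | add a b _ _ ha hb =>
    obtain ⟨s, rfl⟩ := ha
    obtain ⟨t, rfl⟩ := hb
    exact ⟨s + t, by rw [Multiset.map_add, Multiset.sum_add]; rfl⟩
  | neg a _ ha =>
    obtain ⟨s, rfl⟩ := ha
    refine ⟨s.map (fun i => ⟨-i.1, Finset.mem_filter.2 ⟨Finset.mem_univ _,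
      Weight.IsNonZero.neg (Finset.mem_filter.1 i.2).2⟩⟩), ?_⟩
    rw [Multiset.map_map]
    have key : ∀ u : Multiset H.root, -(u.map (rootSystem H).root).sum =
        (u.map ((rootSystem H).root ∘ fun i => ⟨-i.1, Finset.mem_filter.2 ⟨Finset.mem_univ _,
          Weight.IsNonZero.neg (Finset.mem_filter.1 i.2).2⟩⟩)).sum := by
      intro u
      rw [← Multiset.sum_map_neg', Multiset.map_map]
      congr 1
    rw [← key]
    rfl

/-- Let `L` be a finite-dimensional complex semisimple Lie algebra with a
Cartan subalgebra `H`, and let `V` be a nonzero finite-dimensional representation of `L`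
which is weight multiplicity free with respect to `H`. If all weights of `V` are congruent
modulo the root lattice of `L` (the subgroup of `H → ℂ` generated by the nonzero weights of
the adjoint action of `H` on `L`), then `V` is irreducible. -/
theorem weight_multiplicity_free_congruent_irreducible
    {L : Type*} [LieRing L] [LieAlgebra ℂ L] [FiniteDimensional ℂ L]
    [LieAlgebra.IsSemisimple ℂ L]
    (H : LieSubalgebra ℂ L) [H.IsCartanSubalgebra]
    {V : Type*} [AddCommGroup V] [Module ℂ V] [LieRingModule L V] [LieModule ℂ L V]
    [FiniteDimensional ℂ V] [Nontrivial V]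
    (hmf : ∀ χ : H → ℂ, LieModule.genWeightSpace V χ ≠ ⊥ →
      Module.finrank ℂ (LieModule.genWeightSpace V χ) = 1)
    (hcong : ∀ χ₁ χ₂ : H → ℂ, LieModule.genWeightSpace V χ₁ ≠ ⊥ →
      LieModule.genWeightSpace V χ₂ ≠ ⊥ →
      (χ₁ - χ₂) ∈ AddSubgroup.closure
        {α : H → ℂ | α ≠ 0 ∧ LieModule.genWeightSpace L α ≠ ⊥}) :
    LieModule.IsIrreducible ℂ L V := by
  have : LieAlgebra.IsKilling ℂ L := inferInstance
  refine LieModule.IsIrreducible.mk fun W hW => ?_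
  by_contra hWt
  have h2 : ∃ (ν : H → ℂ) (w : V), w ∈ LieModule.genWeightSpace V ν ∧ w ∉ W := by
    by_contra hcon
    push Not at hcon
    apply hWt
    have htop := LieModule.iSup_genWeightSpace_eq_top ℂ H V
    rw [← LieSubmodule.toSubmodule_inj, LieSubmodule.iSup_toSubmodule,
      LieSubmodule.top_toSubmodule] at htop
    rw [← LieSubmodule.toSubmodule_inj, LieSubmodule.top_toSubmodule, eq_top_iff, ← htop]
    exact iSup_le fun ν w hw => hcon ν w hw
  have h1 : ∃ (μ : H → ℂ) (v : V), v ∈ LieModule.genWeightSpace V μ ∧ v ∈ W ∧ v ≠ 0 := by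
    by_contra hcon
    push Not at hcon
    apply hW
    let W' : LieSubmodule ℂ H V :=
      { W.toSubmodule with lie_mem := fun {x m} hm => W.lie_mem (x := (x : L)) hm }
    have hW' : W' = ⊥ := by
      rw [LieModule.eq_iSup_inf_genWeightSpace ℂ H V W', eq_bot_iff]
      refine iSup_le fun χ v hv => ?_
      exact hcon χ v hv.2 hv.1
    rw [LieSubmodule.eq_bot_iff]
    intro m hm
    have : m ∈ W' := hm
    rwa [hW', LieSubmodule.mem_bot] at this
  obtain ⟨ν, w, hw, hwW⟩ := h2
  obtain ⟨μ, v, hv, hvW, hv0⟩ := h1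
  have hμ : LieModule.genWeightSpace V μ ≠ ⊥ := by
    intro hb
    rw [hb, LieSubmodule.mem_bot] at hv
    exact hv0 hv
  have hν : LieModule.genWeightSpace V ν ≠ ⊥ := by
    intro hb
    rw [hb, LieSubmodule.mem_bot] at hw
    exact hwW (hw ▸ W.zero_mem)
  obtain ⟨s, hs⟩ := wmf_exists_multiset H _ (hcong μ ν hμ hν)
  exact wmf_main H hmf W s.card s μ ν v w rfl hv hvW hv0 hw hwW hs
end

section
/- Let m ≥ 4. Consider the action of the group GL₂(ℂ) × SL_{2m}(ℂ) on the vector space ℂ² ⊗ ⋀²(ℂ^{2m}) determined by (A, g) · (v ⊗ ω) = (Av) ⊗ (⋀²g)(ω) and extended linearly. Then this action has infinitely many orbits, i.e. the set of orbits is infinite. -/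
open TensorProduct

/-- The image under the induced algebra map of a degree-`n` element of the exterior algebra
is again of degree `n`. -/
theorem map_mem_exteriorPower {R M N : Type*} [CommRing R] [AddCommGroup M] [Module R M]
    [AddCommGroup N] [Module R N] (f : M →ₗ[R] N) (n : ℕ)
    {x : ExteriorAlgebra R M} (hx : x ∈ ⋀[R]^n M) :
    ExteriorAlgebra.map f x ∈ ⋀[R]^n N := by
  have h : Submodule.map (ExteriorAlgebra.map f).toLinearMap (⋀[R]^n M) ≤ ⋀[R]^n N := by
    rw [ExteriorAlgebra.exteriorPower, ExteriorAlgebra.exteriorPower, Submodule.map_pow, ExteriorAlgebra.ι_range_map_map]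
    exact pow_le_pow_left' (LinearMap.map_le_range) n
  exact h ⟨x, hx, rfl⟩

namespace OrbProof

/-- The alternating map `(u, v) ↦ u vᵀ - v uᵀ`. -/
noncomputable def altM (n : ℕ) : (Fin n → ℂ) [⋀^Fin 2]→ₗ[ℂ] Matrix (Fin n) (Fin n) ℂ where
  toFun v := Matrix.of fun i j => v 0 i * v 1 j - v 1 i * v 0 j
  map_update_add' := by
    intro _ v k x y
    ext i j
    fin_cases k <;> simp [Function.update] <;> ring
  map_update_smul' := by
    intro _ v k c x
    ext i j
    fin_cases k <;> simp [Function.update] <;> ring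
  map_eq_zero_of_eq' := by
    intro v a b h hab
    ext i j
    fin_cases a <;> fin_cases b <;> simp_all

/-- The linear map from the exterior square to skew matrices. -/
noncomputable def T (n : ℕ) : ↥(⋀[ℂ]^2 (Fin n → ℂ)) →ₗ[ℂ] Matrix (Fin n) (Fin n) ℂ :=
  exteriorPower.alternatingMapLinearEquiv (altM n)

/-- The action on the exterior square. -/
noncomputable def act {n : ℕ} (g : Matrix (Fin n) (Fin n) ℂ) :
    ↥(⋀[ℂ]^2 (Fin n → ℂ)) →ₗ[ℂ] ↥(⋀[ℂ]^2 (Fin n → ℂ)) :=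
  LinearMap.restrict (ExteriorAlgebra.map (Matrix.mulVecLin g)).toLinearMap
    (fun _ hx => map_mem_exteriorPower _ 2 hx)

theorem T_act {n : ℕ} (g : Matrix (Fin n) (Fin n) ℂ) (ω : ↥(⋀[ℂ]^2 (Fin n → ℂ))) :
    T n (act g ω) = g * T n ω * g.transpose := by
  have key : (T n) ∘ₗ act g
      = (LinearMap.mulRight ℂ g.transpose ∘ₗ LinearMap.mulLeft ℂ g) ∘ₗ T n := by
    apply exteriorPower.linearMap_ext
    ext1 v
    have h1 : act g (exteriorPower.ιMulti ℂ 2 v)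
        = exteriorPower.ιMulti ℂ 2 (fun i => g.mulVec (v i)) := by
      apply Subtype.ext
      have h3 := ExteriorAlgebra.map_apply_ιMulti (Matrix.mulVecLin g) v
      exact h3
    simp only [LinearMap.compAlternatingMap_apply, LinearMap.comp_apply, h1, T,
      exteriorPower.alternatingMapLinearEquiv_apply_ιMulti, LinearMap.mulRight_apply,
      LinearMap.mulLeft_apply]
    have h2 : ∀ w : Fin 2 → Fin n → ℂ,
        altM n w = Matrix.vecMulVec (w 0) (w 1) - Matrix.vecMulVec (w 1) (w 0) := by
      intro w; ext i j; simp [altM, Matrix.vecMulVec_apply]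
    simp only [h2, Matrix.mul_sub, Matrix.sub_mul, Matrix.mul_vecMulVec, Matrix.vecMulVec_mul,
      Matrix.vecMul_transpose]
  exact LinearMap.congr_fun key ω

/-- Contraction with a covector followed by `T`. -/
noncomputable def Psi (n : ℕ) (l : Fin 2 → ℂ) :
    (Fin 2 → ℂ) ⊗[ℂ] ↥(⋀[ℂ]^2 (Fin n → ℂ)) →ₗ[ℂ] Matrix (Fin n) (Fin n) ℂ :=
  TensorProduct.lift (LinearMap.smulRight (dotProductBilin ℂ ℂ l) (T n))

theorem Psi_tmul (n : ℕ) (l p : Fin 2 → ℂ) (ω : ↥(⋀[ℂ]^2 (Fin n → ℂ))) :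
    Psi n l (p ⊗ₜ ω) = (l ⬝ᵥ p) • T n ω := by
  simp [Psi]

theorem Psi_act {n : ℕ} (A : Matrix (Fin 2) (Fin 2) ℂ) (g : Matrix (Fin n) (Fin n) ℂ)
    (l : Fin 2 → ℂ) (v : (Fin 2 → ℂ) ⊗[ℂ] ↥(⋀[ℂ]^2 (Fin n → ℂ))) :
    Psi n l (TensorProduct.map (Matrix.mulVecLin A) (act g) v)
      = g * Psi n (A.vecMulLinear l) v * g.transpose := by
  induction v using TensorProduct.induction_on with
  | zero => simp
  | tmul p ω =>
    rw [TensorProduct.map_tmul, Psi_tmul, Psi_tmul, T_act, Matrix.mulVecLin_apply,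
      Matrix.dotProduct_mulVec, Matrix.mul_smul, Matrix.smul_mul]
    rfl
  | add x y hx hy => simp [hx, hy, Matrix.mul_add, Matrix.add_mul]

/-- The 2 by 2 determinant. -/
def br (u v : Fin 2 → ℂ) : ℂ := u 0 * v 1 - u 1 * v 0

/-- Cross ratio. -/
noncomputable def cr (u : Fin 4 → Fin 2 → ℂ) : ℂ :=
  (br (u 0) (u 2) * br (u 1) (u 3)) / (br (u 0) (u 3) * br (u 1) (u 2))

theorem br_vecMul (A : Matrix (Fin 2) (Fin 2) ℂ) (u v : Fin 2 → ℂ) :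
    br (Matrix.vecMul u A) (Matrix.vecMul v A) = A.det * br u v := by
  simp [br, Matrix.vecMul, dotProduct, Fin.sum_univ_two, Matrix.det_fin_two]
  ring

theorem cr_vecMul (A : Matrix (Fin 2) (Fin 2) ℂ) (hA : A.det ≠ 0) (u : Fin 4 → Fin 2 → ℂ) :
    cr (fun i => Matrix.vecMul (u i) A) = cr u := by
  simp only [cr, br_vecMul]
  rw [show ∀ a b : ℂ, A.det * a * (A.det * b) = (A.det * A.det) * (a * b) by intros; ring,
    show ∀ a b : ℂ, A.det * a * (A.det * b) = (A.det * A.det) * (a * b) by intros; ring,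
    mul_div_mul_left _ _ (mul_ne_zero hA hA)]

theorem cr_smul (c : Fin 4 → ℂ) (hc : ∀ i, c i ≠ 0) (u : Fin 4 → Fin 2 → ℂ) :
    cr (fun i => c i • u i) = cr u := by
  have h : ∀ (a b : ℂ) (u v : Fin 2 → ℂ), br (a • u) (b • v) = a * b * br u v := by
    intros; simp [br]; ring
  simp only [cr, h]
  rw [show c 0 * c 2 * br (u 0) (u 2) * (c 1 * c 3 * br (u 1) (u 3))
      = (c 0 * c 1 * c 2 * c 3) * (br (u 0) (u 2) * br (u 1) (u 3)) by ring,
    show c 0 * c 3 * br (u 0) (u 3) * (c 1 * c 2 * br (u 1) (u 2))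
      = (c 0 * c 1 * c 2 * c 3) * (br (u 0) (u 3) * br (u 1) (u 2)) by ring,
    mul_div_mul_left]
  simp [hc]

/-- The set of cross ratios of the degenerate covectors. -/
def S {n : ℕ} (v : (Fin 2 → ℂ) ⊗[ℂ] ↥(⋀[ℂ]^2 (Fin n → ℂ))) : Set ℂ :=
  {z | ∃ u : Fin 4 → Fin 2 → ℂ, (∀ i, u i ≠ 0 ∧ (Psi n (u i) v).det = 0) ∧ cr u = z}

theorem S_act {n : ℕ} (A : GL (Fin 2) ℂ) (g : Matrix.SpecialLinearGroup (Fin n) ℂ)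
    (v : (Fin 2 → ℂ) ⊗[ℂ] ↥(⋀[ℂ]^2 (Fin n → ℂ))) :
    S (TensorProduct.map (Matrix.mulVecLin (A : Matrix (Fin 2) (Fin 2) ℂ))
      (act (g : Matrix (Fin n) (Fin n) ℂ)) v) = S v := by
  have hdet : ∀ l, (Psi n l (TensorProduct.map (Matrix.mulVecLin (A : Matrix (Fin 2) (Fin 2) ℂ))
      (act (g : Matrix (Fin n) (Fin n) ℂ)) v)).det
      = (Psi n (Matrix.vecMul l (A : Matrix (Fin 2) (Fin 2) ℂ)) v).det := by
    intro l
    rw [Psi_act]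
    simp
  have hA : (A : Matrix (Fin 2) (Fin 2) ℂ).det ≠ 0 := A.det_ne_zero
  have hA' : ((A⁻¹ : GL (Fin 2) ℂ) : Matrix (Fin 2) (Fin 2) ℂ).det ≠ 0 := (A⁻¹).det_ne_zero
  have e1 : (A : Matrix (Fin 2) (Fin 2) ℂ) * ((A⁻¹ : GL (Fin 2) ℂ) : Matrix (Fin 2) (Fin 2) ℂ) = 1 :=
    A.mul_inv
  have e2 : ((A⁻¹ : GL (Fin 2) ℂ) : Matrix (Fin 2) (Fin 2) ℂ) * (A : Matrix (Fin 2) (Fin 2) ℂ) = 1 :=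
    A.inv_mul
  ext z
  constructor
  · rintro ⟨u, hu, rfl⟩
    refine ⟨fun i => Matrix.vecMul (u i) (A : Matrix (Fin 2) (Fin 2) ℂ), fun i => ⟨?_, ?_⟩,
      cr_vecMul _ hA u⟩
    · intro h
      apply (hu i).1
      have := congrArg (fun x => Matrix.vecMul x ((A⁻¹ : GL (Fin 2) ℂ) : Matrix (Fin 2) (Fin 2) ℂ)) h
      simpa only [Matrix.vecMul_vecMul, e1, Matrix.vecMul_one, Matrix.zero_vecMul] using this
    · rw [← hdet]; exact (hu i).2
  · rintro ⟨u, hu, rfl⟩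
    refine ⟨fun i => Matrix.vecMul (u i) ((A⁻¹ : GL (Fin 2) ℂ) : Matrix (Fin 2) (Fin 2) ℂ),
      fun i => ⟨?_, ?_⟩, cr_vecMul _ hA' u⟩
    · intro h
      apply (hu i).1
      have := congrArg (fun x => Matrix.vecMul x (A : Matrix (Fin 2) (Fin 2) ℂ)) h
      simpa only [Matrix.vecMul_vecMul, e2, Matrix.vecMul_one, Matrix.zero_vecMul] using this
    · rw [hdet, Matrix.vecMul_vecMul, e2, Matrix.vecMul_one]; exact (hu i).2

/-- Four points on the line. -/
def pt (t : ℂ) (k : Fin 4) : Fin 2 → ℂ := (![![1, 0], ![0, 1], ![1, 1], ![1, t]] : Fin 4 → Fin 2 → ℂ) k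

/-- The orthogonal vectors. -/
def qt (t : ℂ) (k : Fin 4) : Fin 2 → ℂ :=
  (![![0, 1], ![1, 0], ![1, -1], ![t, -1]] : Fin 4 → Fin 2 → ℂ) k

theorem qt_ne (t : ℂ) (k : Fin 4) : qt t k ≠ 0 := by
  intro h
  have h0 := congrFun h 0
  have h1 := congrFun h 1
  fin_cases k <;> simp [qt] at h0 h1

theorem qt_pt (t : ℂ) (k : Fin 4) : qt t k ⬝ᵥ pt t k = 0 := by
  fin_cases k <;> simp [qt, pt, dotProduct, Fin.sum_univ_two]

theorem eq_smul_qt (t : ℂ) (k : Fin 4) (u : Fin 2 → ℂ) (hu : u ≠ 0) (h : u ⬝ᵥ pt t k = 0) :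
    ∃ c : ℂ, c ≠ 0 ∧ u = c • qt t k := by
  have : ∃ c : ℂ, u = c • qt t k := by
    fin_cases k <;> simp [pt, dotProduct, Fin.sum_univ_two] at h
    · exact ⟨u 1, by ext i; fin_cases i <;> simp [qt, h]⟩
    · exact ⟨u 0, by ext i; fin_cases i <;> simp [qt, h]⟩
    · exact ⟨u 0, by ext i; fin_cases i <;> simp [qt]; linear_combination h⟩
    · exact ⟨-u 1, by ext i; fin_cases i <;> simp [qt]; linear_combination h⟩
  obtain ⟨c, rfl⟩ := this
  exact ⟨c, fun h => hu (by simp [h]), rfl⟩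

/-- The index attached to a block. -/
def kk {m : ℕ} (i : Fin m) : Fin 4 := if h : (i : ℕ) < 4 then ⟨i, h⟩ else 3

/-- Matrix indices. -/
def ix {m : ℕ} (a : Fin 2) (i : Fin m) : Fin (2 * m) := finProdFinEquiv (a, i)

theorem ix_inj {m : ℕ} (a b : Fin 2) (i j : Fin m) : ix a i = ix b j ↔ a = b ∧ i = j := by
  simp [ix]

/-- The family of tensors. -/
noncomputable def fam (m : ℕ) (t : ℂ) : (Fin 2 → ℂ) ⊗[ℂ] ↥(⋀[ℂ]^2 (Fin (2 * m) → ℂ)) :=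
  ∑ i : Fin m, pt t (kk i) ⊗ₜ
    exteriorPower.ιMulti ℂ 2 ![Pi.single (ix 0 i) (1 : ℂ), Pi.single (ix 1 i) (1 : ℂ)]

theorem Psi_fam (m : ℕ) (t : ℂ) (l : Fin 2 → ℂ) (z : Fin (2 * m) → ℂ) (x : Fin (2 * m)) :
    (Psi (2 * m) l (fam m t)).mulVec z x = ∑ i : Fin m, (l ⬝ᵥ pt t (kk i)) *
      ((Pi.single (ix 0 i) (1 : ℂ) : Fin (2 * m) → ℂ) x * z (ix 1 i)
        - (Pi.single (ix 1 i) (1 : ℂ) : Fin (2 * m) → ℂ) x * z (ix 0 i)) := by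
  have h2 : ∀ w : Fin 2 → Fin (2 * m) → ℂ,
      altM (2 * m) w = Matrix.vecMulVec (w 0) (w 1) - Matrix.vecMulVec (w 1) (w 0) := by
    intro w; ext i j; simp [altM, Matrix.vecMulVec_apply]
  simp only [fam, map_sum, Psi_tmul, T, exteriorPower.alternatingMapLinearEquiv_apply_ιMulti, h2,
    Matrix.sum_mulVec, Matrix.smul_mulVec, Matrix.sub_mulVec, Matrix.vecMulVec_mulVec,
    Finset.sum_apply, Pi.smul_apply, Pi.sub_apply, smul_eq_mul]
  simp

theorem det_fam (m : ℕ) (t : ℂ) (l : Fin 2 → ℂ) :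
    (Psi (2 * m) l (fam m t)).det = 0 ↔ ∃ i : Fin m, l ⬝ᵥ pt t (kk i) = 0 := by
  rw [← Matrix.exists_mulVec_eq_zero_iff]
  constructor
  · rintro ⟨z, hz, h⟩
    by_contra! hc
    apply hz
    have h0 : ∀ i : Fin m, z (ix 1 i) = 0 := by
      intro i
      have := congrFun h (ix 0 i)
      rw [Psi_fam] at this
      have hci := hc i
      generalize hd : (fun i : Fin m => l ⬝ᵥ pt t (kk i)) = d at *
      have hd' : ∀ i, l ⬝ᵥ pt t (kk i) = d i := fun i => congrFun hd i
      simp only [hd'] at this hci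
      simpa [Pi.single_apply, ix_inj, hci] using this
    have h1 : ∀ i : Fin m, z (ix 0 i) = 0 := by
      intro i
      have := congrFun h (ix 1 i)
      rw [Psi_fam] at this
      have hci := hc i
      generalize hd : (fun i : Fin m => l ⬝ᵥ pt t (kk i)) = d at *
      have hd' : ∀ i, l ⬝ᵥ pt t (kk i) = d i := fun i => congrFun hd i
      simp only [hd'] at this hci
      simpa [Pi.single_apply, ix_inj, hci] using this
    ext x
    obtain ⟨⟨a, i⟩, rfl⟩ := finProdFinEquiv.surjective x
    fin_cases a
    · exact h1 i
    · exact h0 i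
  · rintro ⟨i, hi⟩
    refine ⟨Pi.single (ix 0 i) 1, by simp, ?_⟩
    ext x
    rw [Psi_fam]
    apply Finset.sum_eq_zero
    intro j _
    by_cases hj : j = i
    · subst hj; simp [hi]
    · simp [Pi.single_apply, ix_inj, hj]

theorem S_fam_finite (m : ℕ) (t : ℂ) : (S (fam m t)).Finite := by
  refine (Set.finite_range fun f : Fin 4 → Fin 4 => cr (fun i => qt t (f i))).subset ?_
  rintro z ⟨u, hu, rfl⟩
  have : ∀ i, ∃ k, ∃ c : ℂ, c ≠ 0 ∧ u i = c • qt t k := by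
    intro i
    obtain ⟨j, hj⟩ := (det_fam m t (u i)).1 (hu i).2
    exact ⟨_, eq_smul_qt t _ _ (hu i).1 hj⟩
  choose f c hc h using this
  refine ⟨f, ?_⟩
  rw [show u = fun i => c i • qt t (f i) from funext h]
  exact (cr_smul c hc _).symm

theorem mem_S_fam (m : ℕ) (hm : 4 ≤ m) (t : ℂ) : t ∈ S (fam m t) := by
  refine ⟨fun i => qt t ((![0, 1, 3, 2] : Fin 4 → Fin 4) i), fun i => ⟨qt_ne _ _, ?_⟩, ?_⟩
  · rw [det_fam]
    beta_reduce
    generalize (![0, 1, 3, 2] : Fin 4 → Fin 4) i = k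
    refine ⟨⟨k, by omega⟩, ?_⟩
    have : kk (⟨k, by omega⟩ : Fin m) = k := by simp [kk]
    rw [this, qt_pt]
  · simp [cr, br, qt]

end OrbProof

/-- For `m ≥ 4`, the action of `GL₂(ℂ) × SL_{2m}(ℂ)` on
`ℂ² ⊗ ⋀²(ℂ^{2m})` (acting by matrix multiplication on the first factor and by the induced
map on the exterior square on the second) has infinitely many orbits. -/
theorem infinitely_many_orbits_GL2_SL_even
    (m : ℕ) (hm : 4 ≤ m) :
    Infinite (Quot fun v w : (Fin 2 → ℂ) ⊗[ℂ] ↥(⋀[ℂ]^2 (Fin (2 * m) → ℂ)) =>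
      ∃ (A : GL (Fin 2) ℂ) (g : Matrix.SpecialLinearGroup (Fin (2 * m)) ℂ),
        TensorProduct.map (Matrix.mulVecLin (A : Matrix (Fin 2) (Fin 2) ℂ))
          (LinearMap.restrict
            (ExteriorAlgebra.map
              (Matrix.mulVecLin (g : Matrix (Fin (2 * m)) (Fin (2 * m)) ℂ))).toLinearMap
            (fun x hx => map_mem_exteriorPower _ 2 hx)) v = w) := by
  rw [← not_finite_iff_infinite]
  intro hfin
  let F := Quot.lift (fun v => OrbProof.S (n := 2 * m) v) (by
    rintro v w ⟨A, g, rfl⟩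
    exact (OrbProof.S_act A g v).symm : ∀ v w, (∃ (A : GL (Fin 2) ℂ)
      (g : Matrix.SpecialLinearGroup (Fin (2 * m)) ℂ),
        TensorProduct.map (Matrix.mulVecLin (A : Matrix (Fin 2) (Fin 2) ℂ))
          (LinearMap.restrict
            (ExteriorAlgebra.map
              (Matrix.mulVecLin (g : Matrix (Fin (2 * m)) (Fin (2 * m)) ℂ))).toLinearMap
            (fun x hx => map_mem_exteriorPower _ 2 hx)) v = w) →
        OrbProof.S (n := 2 * m) v = OrbProof.S (n := 2 * m) w)
  have hU : (⋃ q ∈ {q | (F q).Finite}, F q).Finite :=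
    Set.Finite.biUnion (Set.toFinite _) (fun q hq => hq)
  apply Set.infinite_univ (α := ℂ)
  refine hU.subset ?_
  intro t _
  refine Set.mem_biUnion (x := Quot.mk _ (OrbProof.fam m t)) ?_ ?_
  · exact OrbProof.S_fam_finite m t
  · exact OrbProof.mem_S_fam m hm t
end

section
/- Let m ≥ 4. Consider the action of the group GL₂(ℂ) × SL_{2m+1}(ℂ) on the vector space ℂ² ⊗ ⋀²(ℂ^{2m+1}) determined by (A, g) · (v ⊗ ω) = (Av) ⊗ (⋀²g)(ω) and extended linearly. Then this action has infinitely many orbits, i.e. the set of orbits is infinite. -/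
open TensorProduct

/-- The alternating map `(u, v) ↦ u vᵀ - v uᵀ`. -/
noncomputable def skewAlt (n : ℕ) :
    (Fin n → ℂ) [⋀^Fin 2]→ₗ[ℂ] Matrix (Fin n) (Fin n) ℂ where
  toFun v := Matrix.vecMulVec (v 0) (v 1) - Matrix.vecMulVec (v 1) (v 0)
  map_update_add' := by
    intro _ v i x y
    ext a b
    fin_cases i <;> simp [Matrix.vecMulVec_apply] <;> ring
  map_update_smul' := by
    intro _ v i x y
    ext a b
    fin_cases i <;> simp [Matrix.vecMulVec_apply] <;> ring
  map_eq_zero_of_eq' := by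
    intro v i j h hij
    have : v 0 = v 1 := by
      fin_cases i <;> fin_cases j <;> simp_all
    simp [this]

/-- The induced map from the exterior square to matrices. -/
noncomputable def skewMat (n : ℕ) :
    ↥(⋀[ℂ]^2 (Fin n → ℂ)) →ₗ[ℂ] Matrix (Fin n) (Fin n) ℂ :=
  exteriorPower.alternatingMapLinearEquiv (skewAlt n)

/-- The map induced on the exterior square. -/
noncomputable def extMap {n : ℕ} (g : Matrix (Fin n) (Fin n) ℂ) :
    ↥(⋀[ℂ]^2 (Fin n → ℂ)) →ₗ[ℂ] ↥(⋀[ℂ]^2 (Fin n → ℂ)) :=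
  LinearMap.restrict
            (ExteriorAlgebra.map
              (Matrix.mulVecLin g)).toLinearMap
            (fun x hx => map_mem_exteriorPower _ 2 hx)

theorem extMap_ιMulti {n : ℕ} (g : Matrix (Fin n) (Fin n) ℂ) (v : Fin 2 → Fin n → ℂ) :
    extMap g (exteriorPower.ιMulti ℂ 2 v) =
      exteriorPower.ιMulti ℂ 2 (fun i => g.mulVec (v i)) := by
  apply Subtype.ext
  change ExteriorAlgebra.map g.mulVecLin (ExteriorAlgebra.ιMulti ℂ 2 v) =
    ExteriorAlgebra.ιMulti ℂ 2 (fun i => g.mulVec (v i))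
  rw [ExteriorAlgebra.map_apply_ιMulti]
  rfl

theorem skewMat_ιMulti {n : ℕ} (v : Fin 2 → Fin n → ℂ) :
    skewMat n (exteriorPower.ιMulti ℂ 2 v) =
      Matrix.vecMulVec (v 0) (v 1) - Matrix.vecMulVec (v 1) (v 0) := by
  simp only [skewMat, exteriorPower.alternatingMapLinearEquiv_apply_ιMulti]
  rfl

theorem skewMat_extMap {n : ℕ} (g : Matrix (Fin n) (Fin n) ℂ) (x : ↥(⋀[ℂ]^2 (Fin n → ℂ))) :
    skewMat n (extMap g x) = g * skewMat n x * g.transpose := by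
  have h : skewMat n ∘ₗ extMap g =
      (LinearMap.mulRight ℂ g.transpose ∘ₗ LinearMap.mulLeft ℂ g) ∘ₗ skewMat n := by
    apply exteriorPower.linearMap_ext
    ext1 v
    simp [extMap_ιMulti, skewMat_ιMulti, mul_sub, sub_mul, Matrix.mul_vecMulVec,
      Matrix.vecMulVec_mul, Matrix.vecMul_transpose]
  exact LinearMap.congr_fun h x

/-- Contraction with `f`. -/
noncomputable def contr (n : ℕ) (f : Fin 2 → ℂ) :
    (Fin 2 → ℂ) ⊗[ℂ] ↥(⋀[ℂ]^2 (Fin n → ℂ)) →ₗ[ℂ] Matrix (Fin n) (Fin n) ℂ :=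
  TensorProduct.lift ((LinearMap.lsmul ℂ _).compr₂ (skewMat n) ∘ₗ (dotProductBilin ℂ ℂ f))

theorem contr_tmul {n : ℕ} (f v : Fin 2 → ℂ) (x : ↥(⋀[ℂ]^2 (Fin n → ℂ))) :
    contr n f (v ⊗ₜ x) = (f ⬝ᵥ v) • skewMat n x := by
  simp [contr, add_smul]

theorem contr_map {n : ℕ} (f : Fin 2 → ℂ) (A : Matrix (Fin 2) (Fin 2) ℂ)
    (g : Matrix (Fin n) (Fin n) ℂ) (x : (Fin 2 → ℂ) ⊗[ℂ] ↥(⋀[ℂ]^2 (Fin n → ℂ))) :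
    contr n f (TensorProduct.map A.mulVecLin (extMap g) x) =
      g * contr n (Matrix.vecMul f A) x * g.transpose := by
  induction x with
  | zero => simp
  | add x y hx hy => simp only [map_add, hx, hy, mul_add, add_mul]
  | tmul v x =>
    rw [TensorProduct.map_tmul, contr_tmul, contr_tmul, skewMat_extMap, Matrix.mulVecLin_apply,
      Matrix.dotProduct_mulVec, Matrix.mul_smul, Matrix.smul_mul]

/-- The forms for which the contraction has small rank. -/
def degen {n : ℕ} (x : (Fin 2 → ℂ) ⊗[ℂ] ↥(⋀[ℂ]^2 (Fin n → ℂ))) : Set (Fin 2 → ℂ) :=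
  {f | (contr n f x).rank < 8}

theorem degen_map {n : ℕ} (f : Fin 2 → ℂ) (A : Matrix (Fin 2) (Fin 2) ℂ)
    (g : Matrix (Fin n) (Fin n) ℂ) (hg : g.det = 1)
    (x : (Fin 2 → ℂ) ⊗[ℂ] ↥(⋀[ℂ]^2 (Fin n → ℂ))) :
    f ∈ degen (TensorProduct.map A.mulVecLin (extMap g) x) ↔ Matrix.vecMul f A ∈ degen x := by
  simp only [degen, Set.mem_setOf_eq, contr_map]
  rw [Matrix.rank_mul_eq_left_of_isUnit_det _ _ (by simp [hg]),
    Matrix.rank_mul_eq_right_of_isUnit_det _ _ (by simp [hg])]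

/-- The determinant of two plane vectors. -/
def dt (f g : Fin 2 → ℂ) : ℂ := f 0 * g 1 - f 1 * g 0

theorem dt_vecMul (f g : Fin 2 → ℂ) (A : Matrix (Fin 2) (Fin 2) ℂ) :
    dt (Matrix.vecMul f A) (Matrix.vecMul g A) = dt f g * A.det := by
  simp [dt, Matrix.vecMul, dotProduct, Fin.sum_univ_two, Matrix.det_fin_two]
  ring

/-- The set of cross ratios of degenerate forms. -/
def crs {n : ℕ} (x : (Fin 2 → ℂ) ⊗[ℂ] ↥(⋀[ℂ]^2 (Fin n → ℂ))) : Set ℂ :=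
  {c | ∃ f : Fin 4 → Fin 2 → ℂ, (∀ i, f i ∈ degen x) ∧ dt (f 0) (f 3) ≠ 0 ∧ dt (f 1) (f 2) ≠ 0 ∧
    c = dt (f 0) (f 2) * dt (f 1) (f 3) / (dt (f 0) (f 3) * dt (f 1) (f 2))}

theorem crs_map {n : ℕ} (A : Matrix (Fin 2) (Fin 2) ℂ) (hA : IsUnit A)
    (g : Matrix (Fin n) (Fin n) ℂ) (hg : g.det = 1)
    (x : (Fin 2 → ℂ) ⊗[ℂ] ↥(⋀[ℂ]^2 (Fin n → ℂ))) :
    crs (TensorProduct.map A.mulVecLin (extMap g) x) = crs x := by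
  have hd : A.det ≠ 0 := ((Matrix.isUnit_iff_isUnit_det A).1 hA).ne_zero
  have key : ∀ f : Fin 4 → Fin 2 → ℂ,
      dt (f 0) (f 2) * dt (f 1) (f 3) / (dt (f 0) (f 3) * dt (f 1) (f 2)) =
      dt (f 0) (f 2) * A.det * (dt (f 1) (f 3) * A.det) /
        (dt (f 0) (f 3) * A.det * (dt (f 1) (f 2) * A.det)) := by
    intro f
    rw [mul_mul_mul_comm, mul_mul_mul_comm (dt (f 0) (f 3)),
      mul_div_mul_right _ _ (mul_ne_zero hd hd)]
  ext c
  constructor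
  · rintro ⟨f, h, h1, h2, rfl⟩
    refine ⟨fun i => Matrix.vecMul (f i) A, fun i => (degen_map _ A g hg x).1 (h i), ?_, ?_, ?_⟩
    · simp [dt_vecMul, h1, hd]
    · simp [dt_vecMul, h2, hd]
    · simp only [dt_vecMul]
      exact key f
  · rintro ⟨f, h, h1, h2, rfl⟩
    have hs : ∀ i, ∃ f', Matrix.vecMul f' A = f i := fun i =>
      ⟨Matrix.vecMul (f i) A⁻¹, by
        rw [Matrix.vecMul_vecMul, Matrix.nonsing_inv_mul _ (by simpa using hd), Matrix.vecMul_one]⟩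
    choose f' hf' using hs
    simp only [← hf', dt_vecMul] at h1 h2 ⊢
    refine ⟨f', fun i => (degen_map _ A g hg x).2 (by rw [hf']; exact h i),
      left_ne_zero_of_mul h1, left_ne_zero_of_mul h2, (key f').symm⟩

/-- The four points. -/
def pts (t : ℂ) : Fin 4 → Fin 2 → ℂ := ![![1, 0], ![0, 1], ![1, 1], ![t, 1]]

/-- The embedding of indices. -/
def emb {n : ℕ} (hn : 8 ≤ n) (p : Fin 2 × Fin 4) : Fin n :=
  ⟨2 * p.2.1 + p.1.1, by have := p.1.2; have := p.2.2; omega⟩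

theorem emb_inj {n : ℕ} (hn : 8 ≤ n) : Function.Injective (emb hn) := by
  rintro ⟨a, b⟩ ⟨c, d⟩ h
  simp only [emb, Fin.mk.injEq] at h
  ext <;> simp <;> omega

/-- The family of tensors. -/
noncomputable def fam {n : ℕ} (hn : 8 ≤ n) (t : ℂ) :
    (Fin 2 → ℂ) ⊗[ℂ] ↥(⋀[ℂ]^2 (Fin n → ℂ)) :=
  ∑ i, pts t i ⊗ₜ exteriorPower.ιMulti ℂ 2 (fun j => Pi.single (emb hn (j, i)) 1)

/-- Inclusion matrix. -/
def incl {n : ℕ} (hn : 8 ≤ n) : Matrix (Fin n) (Fin 2 × Fin 4) ℂ :=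
  Matrix.of fun a p => if a = emb hn p then 1 else 0

theorem incl_tr_mul {n : ℕ} (hn : 8 ≤ n) : (incl hn).transpose * incl hn = 1 := by
  ext p q
  simp [incl, Matrix.mul_apply, Matrix.one_apply, (emb_inj hn).eq_iff, eq_comm]

/-- The block matrix. -/
noncomputable def blk (a : Fin 4 → ℂ) : Matrix (Fin 2 × Fin 4) (Fin 2 × Fin 4) ℂ :=
  Matrix.blockDiagonal fun i => !![0, a i; -a i, 0]

theorem contr_fam {n : ℕ} (hn : 8 ≤ n) (t : ℂ) (f : Fin 2 → ℂ) :
    contr n f (fam hn t) = incl hn * blk (fun i => f ⬝ᵥ pts t i) * (incl hn).transpose := by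
  ext a b
  simp only [fam, map_sum, contr_tmul, skewMat_ιMulti, Matrix.mul_apply, Matrix.sum_apply,
    Fintype.sum_prod_type, blk, Matrix.blockDiagonal_apply, Fin.sum_univ_two]
  simp [incl, Matrix.vecMulVec_apply, Pi.single_apply, ← Finset.sum_add_distrib]
  refine Finset.sum_congr rfl fun i _ => ?_
  split_ifs <;> ring

theorem rank_incl {n : ℕ} (hn : 8 ≤ n) (N : Matrix (Fin 2 × Fin 4) (Fin 2 × Fin 4) ℂ) :
    (incl hn * N * (incl hn).transpose).rank = N.rank := by
  apply le_antisymm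
  · exact (Matrix.rank_mul_le_left _ _).trans (Matrix.rank_mul_le_right _ _)
  · have : N = (incl hn).transpose * (incl hn * N * (incl hn).transpose) * incl hn := by
      simp only [Matrix.mul_assoc, incl_tr_mul, Matrix.mul_one]
      rw [← Matrix.mul_assoc, incl_tr_mul, Matrix.one_mul]
    conv_lhs => rw [this]
    exact (Matrix.rank_mul_le_left _ _).trans (Matrix.rank_mul_le_right _ _)

theorem det_blk (a : Fin 4 → ℂ) : (blk a).det = ∏ i, (a i * a i) := by
  simp [blk, Matrix.det_blockDiagonal, Matrix.det_fin_two]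

theorem rank_blk (a : Fin 4 → ℂ) : (blk a).rank < 8 ↔ ∃ i, a i = 0 := by
  have hdet : (∃ i, a i = 0) ↔ (blk a).det = 0 := by
    simp [det_blk, Finset.prod_eq_zero_iff]
  rw [hdet]
  constructor
  · intro h
    by_contra hne
    have := Matrix.rank_of_isUnit (blk a)
      ((Matrix.isUnit_iff_isUnit_det _).2 (isUnit_iff_ne_zero.2 hne))
    simp at this
    omega
  · intro h
    by_contra hlt
    obtain ⟨v, hv, hv0⟩ := Matrix.exists_mulVec_eq_zero_iff.2 h
    have h1 := LinearMap.finrank_range_add_finrank_ker (blk a).mulVecLin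
    have h2 : 0 < Module.finrank ℂ (LinearMap.ker (blk a).mulVecLin) := by
      rw [Module.finrank_pos_iff]
      exact ⟨⟨v, by simpa using hv0⟩, 0, fun h => hv (by simpa using h)⟩
    have h3 : (blk a).rank = Module.finrank ℂ (LinearMap.range (blk a).mulVecLin) := rfl
    simp at h1
    omega

theorem mem_degen_fam {n : ℕ} (hn : 8 ≤ n) (t : ℂ) (f : Fin 2 → ℂ) :
    f ∈ degen (fam hn t) ↔ ∃ i, f ⬝ᵥ pts t i = 0 := by
  simp only [degen, Set.mem_setOf_eq, contr_fam, rank_incl, rank_blk]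

/-- The orthogonal vector. -/
def perp (p : Fin 2 → ℂ) : Fin 2 → ℂ := ![p 1, - p 0]

theorem mem_crs_fam {n : ℕ} (hn : 8 ≤ n) (t : ℂ) : t ∈ crs (fam hn t) := by
  refine ⟨fun i => perp (pts t i), fun i => (mem_degen_fam hn t _).2 ⟨i, ?_⟩, ?_, ?_, ?_⟩
  · simp [perp, dotProduct, Fin.sum_univ_two]; ring
  all_goals simp [dt, perp, pts]

theorem exists_smul_perp (f p : Fin 2 → ℂ) (hp : p ≠ 0) (h : f ⬝ᵥ p = 0) :
    ∃ s : ℂ, f = s • perp p := by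
  simp only [dotProduct, Fin.sum_univ_two] at h
  by_cases h0 : p 0 = 0
  · have h1 : p 1 ≠ 0 := fun h1 => hp (by ext i; fin_cases i <;> simp [h0, h1])
    have hf : f 1 = 0 := by simpa [h0, h1] using h
    refine ⟨f 0 / p 1, ?_⟩
    ext i
    fin_cases i <;> simp [perp, h0, hf, h1]
  · refine ⟨- f 1 / p 0, ?_⟩
    ext i
    fin_cases i
    · simp [perp]
      field_simp
      linear_combination h
    · simp [perp]
      field_simp

theorem pts_ne (t : ℂ) (i : Fin 4) : pts t i ≠ 0 := by
  intro h
  have h0 := congrFun h 0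
  have h1 := congrFun h 1
  fin_cases i <;> simp [pts] at h0 h1

theorem dt_smul (s r : ℂ) (p q : Fin 2 → ℂ) : dt (s • p) (r • q) = s * r * dt p q := by
  simp [dt]; ring

theorem crs_fam_finite {n : ℕ} (hn : 8 ≤ n) (t : ℂ) : (crs (fam hn t)).Finite := by
  refine (Set.finite_range (fun σ : Fin 4 → Fin 4 =>
    (fun f : Fin 4 → Fin 2 → ℂ =>
      dt (f 0) (f 2) * dt (f 1) (f 3) / (dt (f 0) (f 3) * dt (f 1) (f 2)))
      (fun i => perp (pts t (σ i))))).subset ?_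
  rintro c ⟨f, h, h1, h2, rfl⟩
  choose σ hσ using fun i => (mem_degen_fam hn t _).1 (h i)
  choose s hs using fun i => exists_smul_perp _ _ (pts_ne t _) (hσ i)
  refine ⟨σ, ?_⟩
  rw [hs 0, hs 3, dt_smul] at h1
  rw [hs 1, hs 2, dt_smul] at h2
  have a0 := left_ne_zero_of_mul (left_ne_zero_of_mul h1)
  have a3 := right_ne_zero_of_mul (left_ne_zero_of_mul h1)
  have a1 := left_ne_zero_of_mul (left_ne_zero_of_mul h2)
  have a2 := right_ne_zero_of_mul (left_ne_zero_of_mul h2)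
  have b1 := right_ne_zero_of_mul h1
  have b2 := right_ne_zero_of_mul h2
  rw [hs 0, hs 1, hs 2, hs 3]
  simp only [dt_smul]
  field_simp

/-- For `m ≥ 4`, the action of `GL₂(ℂ) × SL_{2m+1}(ℂ)` on
`ℂ² ⊗ ⋀²(ℂ^{2m+1})` (acting by matrix multiplication on the first factor and by the induced
map on the exterior square on the second) has infinitely many orbits. -/
theorem infinitely_many_orbits_GL2_SL_odd
    (m : ℕ) (hm : 4 ≤ m) :
    Infinite (Quot fun v w : (Fin 2 → ℂ) ⊗[ℂ] ↥(⋀[ℂ]^2 (Fin (2 * m + 1) → ℂ)) =>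
      ∃ (A : GL (Fin 2) ℂ) (g : Matrix.SpecialLinearGroup (Fin (2 * m + 1)) ℂ),
        TensorProduct.map (Matrix.mulVecLin (A : Matrix (Fin 2) (Fin 2) ℂ))
          (LinearMap.restrict
            (ExteriorAlgebra.map
              (Matrix.mulVecLin (g : Matrix (Fin (2 * m + 1)) (Fin (2 * m + 1)) ℂ))).toLinearMap
            (fun x hx => map_mem_exteriorPower _ 2 hx)) v = w) := by
  have hn : 8 ≤ 2 * m + 1 := by omega
  by_contra hfin
  rw [not_infinite_iff_finite] at hfin
  let F := Quot.lift (r := fun v w : (Fin 2 → ℂ) ⊗[ℂ] ↥(⋀[ℂ]^2 (Fin (2 * m + 1) → ℂ)) =>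
      ∃ (A : GL (Fin 2) ℂ) (g : Matrix.SpecialLinearGroup (Fin (2 * m + 1)) ℂ),
        TensorProduct.map (Matrix.mulVecLin (A : Matrix (Fin 2) (Fin 2) ℂ))
          (LinearMap.restrict
            (ExteriorAlgebra.map
              (Matrix.mulVecLin (g : Matrix (Fin (2 * m + 1)) (Fin (2 * m + 1)) ℂ))).toLinearMap
            (fun x hx => map_mem_exteriorPower _ 2 hx)) v = w) crs (by
      rintro v w ⟨A, g, rfl⟩
      exact (crs_map _ A.isUnit _ g.2 v).symm)
  have hF : (⋃ q, ⋃ (_ : (F q).Finite), F q).Finite :=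
    Set.finite_iUnion fun q => Set.finite_iUnion fun h => h
  refine Set.infinite_univ (α := ℂ) (hF.subset fun t _ => ?_)
  simp only [Set.mem_iUnion]
  exact ⟨Quot.mk _ (fam hn t), crs_fam_finite hn t, mem_crs_fam hn t⟩
end
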